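/- (Upper bound, zero-order Γ-limit of the edge energies) Let Ω ⊆ ℝ² be open, bounded, with Lipschitz boundary. For every μ ∈ X(Ω) there exists a family (u_ε)_{ε∈(0,1)} of displacements u_ε : ℤ² → ℝ such that the restricted discrete vorticity measures μ_{u_ε,ε}↾Ω converge flat to μ as ε → 0 and limsup_{ε→0} (1/|log ε|)·F_ε^{edge}(u_ε,Ω) ≤ π·|μ|(Ω). -/

import Mathlib

open scoped Classical

open scoped ENNReal

/-- The plane `ℝ²` with the Euclidean norm. -/
abbrev Plane : Type := EuclideanSpace ℝ (Fin 2)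

/-- The lattice point `i ∈ ℤ²` viewed as a point of the plane. -/
noncomputable def toPlane (i : ℤ × ℤ) : Plane :=
  (WithLp.equiv 2 (Fin 2 → ℝ)).symm ![(i.1 : ℝ), (i.2 : ℝ)]

/-- `Z_ε^{e}(A)`: the lattice points `i` such that the closed segment `[εi, ε(i+e)]`
is contained in `A`. -/
def latticeSeg (ε : ℝ) (e : ℤ × ℤ) (A : Set Plane) : Set (ℤ × ℤ) :=
  {i | segment ℝ (ε • toPlane i) (ε • toPlane (i + e)) ⊆ A}

/-- The distance of a real number to the set of integers. -/
noncomputable def distZ (t : ℝ) : ℝ := ⨅ n : ℤ, |t - n|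

/-- The distance of a real number to the set of half-integers `(1/2)ℤ`. -/
noncomputable def distHalfZ (t : ℝ) : ℝ := ⨅ n : ℤ, |t - n / 2|

/-- The interaction potential `f₀(t) = 2π²t²`. -/
noncomputable def f0 (t : ℝ) : ℝ := 2 * Real.pi ^ 2 * t ^ 2

/-- The interaction potential `f₁(t) = 2π²·dist(t,ℤ)²`. -/
noncomputable def f1 (t : ℝ) : ℝ := 2 * Real.pi ^ 2 * distZ t ^ 2

/-- The interaction potential `f_{1/2}(t) = 2π²·dist(t,(1/2)ℤ)²`. -/
noncomputable def fHalf (t : ℝ) : ℝ := 2 * Real.pi ^ 2 * distHalfZ t ^ 2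

/-- The edge-dislocation energy `F_ε^{edge}(u,A)`, a sum in `[0,∞]`. -/
noncomputable def Fedge (ε : ℝ) (u : ℤ × ℤ → ℝ) (A : Set Plane) : ℝ≥0∞ :=
  (∑' i : latticeSeg ε (1, 0) A, ENNReal.ofReal (f0 (u ((i : ℤ × ℤ) + (1, 0)) - u (i : ℤ × ℤ))))
    + ∑' i : latticeSeg ε (0, 1) A, ENNReal.ofReal (f1 (u ((i : ℤ × ℤ) + (0, 1)) - u (i : ℤ × ℤ)))

/-- The screw-dislocation energy `F_ε^{screw}(u,A)`, a sum in `[0,∞]`. -/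
noncomputable def Fscrew (ε : ℝ) (u : ℤ × ℤ → ℝ) (A : Set Plane) : ℝ≥0∞ :=
  (∑' i : latticeSeg ε (1, 0) A, ENNReal.ofReal (f1 (u ((i : ℤ × ℤ) + (1, 0)) - u (i : ℤ × ℤ))))
    + ∑' i : latticeSeg ε (0, 1) A, ENNReal.ofReal (f1 (u ((i : ℤ × ℤ) + (0, 1)) - u (i : ℤ × ℤ)))

/-- The partial-edge-dislocation energy `F_ε^{p-edge}(u,A)` (with parameter `α`),
a sum in `[0,∞]`. -/
noncomputable def Fpedge (α ε : ℝ) (u : ℤ × ℤ → ℝ) (A : Set Plane) : ℝ≥0∞ :=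
  (∑' i : latticeSeg ε (1, 0) A, ENNReal.ofReal (f0 (u ((i : ℤ × ℤ) + (1, 0)) - u (i : ℤ × ℤ))))
    + (∑' i : latticeSeg ε (0, 1) A,
        ENNReal.ofReal (fHalf (u ((i : ℤ × ℤ) + (0, 1)) - u (i : ℤ × ℤ))))
    + ENNReal.ofReal (α / Real.pi ^ 2 * ε) *
        ∑' i : latticeSeg ε (0, 2) A, ENNReal.ofReal (f1 (u ((i : ℤ × ℤ) + (0, 2)) - u (i : ℤ × ℤ)))

/-- The elastic part `E(t) = t − ⌈t − 1/2⌉` of an increment `t`. -/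
noncomputable def elast (t : ℝ) : ℝ := t - ⌈t - 1 / 2⌉

/-- The center `ε(i + (1/2,1/2))` of the lattice square with lower-left corner `εi`. -/
noncomputable def center (ε : ℝ) (i : ℤ × ℤ) : Plane :=
  (WithLp.equiv 2 (Fin 2 → ℝ)).symm ![ε * ((i.1 : ℝ) + 1 / 2), ε * ((i.2 : ℝ) + 1 / 2)]

/-- The circulation `m_u(i)` of the elastic increments of `u` around the square at `i`. -/
noncomputable def mCirc (u : ℤ × ℤ → ℝ) (i : ℤ × ℤ) : ℝ :=
  elast (u (i + (1, 0)) - u i) + elast (u (i + (1, 1)) - u (i + (1, 0)))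
    - elast (u (i + (1, 1)) - u (i + (0, 1))) - elast (u (i + (0, 1)) - u i)

/-- The discrete vorticity measure `μ_{u,ε}↾Ω`, viewed as a finitely supported real linear
combination of Dirac masses, encoded by its coefficient function: only squares whose center
`ε(i+(1/2,1/2))` lies in `Ω` are kept. -/
noncomputable def vortMeas (ε : ℝ) (u : ℤ × ℤ → ℝ) (Ω : Set Plane) : Plane → ℝ :=
  fun p => ∑ᶠ (i : ℤ × ℤ) (_ : center ε i = p ∧ center ε i ∈ Ω), mCirc u i

/-- The flat norm (relative to `Ω`) of a finite real combination of Dirac masses encoded by its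
coefficient function `m`:
`‖T‖_flat = sup{ Σ_x m(x)ψ(x) : ψ smooth, compactly supported in Ω, ‖ψ‖_∞ ≤ 1, ‖∇ψ‖_∞ ≤ 1}`. -/
noncomputable def flatNorm (Ω : Set Plane) (m : Plane → ℝ) : ℝ :=
  sSup {r : ℝ | ∃ ψ : Plane → ℝ, ContDiff ℝ (⊤ : ℕ∞) ψ ∧ HasCompactSupport ψ ∧ tsupport ψ ⊆ Ω ∧
    (∀ p, |ψ p| ≤ 1) ∧ (∀ p, ‖fderiv ℝ ψ p‖ ≤ 1) ∧ r = ∑ᶠ p, m p * ψ p}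

/-- `Ω ⊆ ℝ²` has Lipschitz boundary: near every boundary point, `Ω` coincides with the rotated
subgraph of a Lipschitz function `φ : ℝ → ℝ`. -/
def HasLipschitzBoundary (Ω : Set Plane) : Prop :=
  ∀ x ∈ frontier Ω, ∃ r : ℝ, 0 < r ∧ ∃ R : Plane ≃ₗᵢ[ℝ] Plane,
    LinearMap.det (R.toLinearEquiv : Plane →ₗ[ℝ] Plane) = 1 ∧
    ∃ K : NNReal, ∃ φ : ℝ → ℝ, LipschitzWith K φ ∧
      Ω ∩ Metric.ball x r
        = {p : Plane | ∃ y : Plane, p = x + R y ∧ y 1 < φ (y 0)} ∩ Metric.ball x r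

noncomputable def HH (p q : ℤ) : ℝ :=
  Real.arctan (((p : ℝ) + 1 / 2) / ((q : ℝ) - 1 / 2)) -
    Real.arctan (((p : ℝ) - 1 / 2) / ((q : ℝ) - 1 / 2))

lemma hint_ne (q : ℤ) : (q : ℝ) - 1 / 2 ≠ 0 := by
  intro h
  have h2 : (2 * q : ℝ) = 1 := by linarith
  have h3 : (2 * q : ℤ) = 1 := by exact_mod_cast h2
  omega

lemma hint_pos (q : ℤ) (h : 0 < q) : (1 / 2 : ℝ) ≤ (q : ℝ) - 1 / 2 := by
  have : (1 : ℝ) ≤ q := by exact_mod_cast h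
  linarith

lemma hint_neg (q : ℤ) (h : ¬ 0 < q) : (q : ℝ) - 1 / 2 ≤ - (1 / 2) := by
  have : (q : ℝ) ≤ 0 := by exact_mod_cast (not_lt.mp h)
  linarith

/-- reflection in q -/
lemma HH_neg_q (p q : ℤ) : HH p (1 - q) = - HH p q := by
  have h : ((1 - q : ℤ) : ℝ) - 1 / 2 = -((q : ℝ) - 1 / 2) := by push_cast; ring
  unfold HH
  rw [h, div_neg, div_neg, Real.arctan_neg, Real.arctan_neg]
  ring

lemma HH_neg_p (p q : ℤ) : HH (-p) q = HH p q := by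
  unfold HH
  have h1 : (((-p : ℤ) : ℝ) + 1 / 2) / ((q : ℝ) - 1 / 2) = -(((p : ℝ) - 1 / 2) / ((q : ℝ) - 1 / 2)) := by
    push_cast; ring
  have h2 : (((-p : ℤ) : ℝ) - 1 / 2) / ((q : ℝ) - 1 / 2) = -(((p : ℝ) + 1 / 2) / ((q : ℝ) - 1 / 2)) := by
    push_cast; ring
  rw [h1, h2, Real.arctan_neg, Real.arctan_neg]
  ring

lemma hasDerivAt_arctan_div (y : ℝ) (hy : 0 < y) (t : ℝ) :
    HasDerivAt (fun t => Real.arctan (t / y)) (y / (t ^ 2 + y ^ 2)) t := by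
  have h := ((hasDerivAt_id t).div_const y).arctan
  refine HasDerivAt.congr_deriv h ?_
  change 1 / (1 + (t / y) ^ 2) * (1 / y) = y / (t ^ 2 + y ^ 2)
  have : t ^ 2 + y ^ 2 ≠ 0 := by positivity
  have : 1 + (t / y) ^ 2 ≠ 0 := by positivity
  field_simp
  ring

lemma arctan_step (y : ℝ) (hy : 0 < y) (x : ℝ) :
    ∃ η, x < η ∧ η < x + 1 ∧
      Real.arctan ((x + 1) / y) - Real.arctan (x / y) = y / (η ^ 2 + y ^ 2) := by
  obtain ⟨c, hc, h⟩ := exists_hasDerivAt_eq_slope (fun t => Real.arctan (t / y))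
    (fun t => y / (t ^ 2 + y ^ 2)) (by linarith : x < x + 1)
    (fun t _ => (hasDerivAt_arctan_div y hy t).continuousAt.continuousWithinAt)
    (fun t _ => hasDerivAt_arctan_div y hy t)
  refine ⟨c, hc.1, hc.2, ?_⟩
  rw [h]; simp

noncomputable def GG (y t : ℝ) : ℝ := (t / (t ^ 2 + y ^ 2) + Real.arctan (t / y) / y) / 2

lemma hasDerivAt_GG (y : ℝ) (hy : 0 < y) (t : ℝ) :
    HasDerivAt (GG y) (y ^ 2 / (t ^ 2 + y ^ 2) ^ 2) t := by
  have h0 : t ^ 2 + y ^ 2 ≠ 0 := by positivity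
  have h1 := (((hasDerivAt_id t).div (((hasDerivAt_pow 2 t).add_const (y ^ 2))) h0).add
    ((hasDerivAt_arctan_div y hy t).div_const y)).div_const 2
  refine HasDerivAt.congr_deriv h1 ?_
  change ((1 * (t ^ 2 + y ^ 2) - t * ((2 : ℕ) * t ^ (2 - 1))) / (t ^ 2 + y ^ 2) ^ 2 + y / (t ^ 2 + y ^ 2) / y) / 2 = y ^ 2 / (t ^ 2 + y ^ 2) ^ 2
  push_cast
  field_simp
  ring

lemma GG_mono (y : ℝ) (hy : 0 < y) : Monotone (GG y) :=
  monotone_of_hasDerivAt_nonneg (fun t => hasDerivAt_GG y hy t) (fun t => by positivity)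

lemma GG_le (y : ℝ) (hy : 0 < y) (t : ℝ) : GG y t ≤ Real.pi / (4 * y) := by
  refine (GG_mono y hy).ge_of_tendsto ?_ t
  have h1 : Filter.Tendsto (fun t : ℝ => t / (t ^ 2 + y ^ 2)) Filter.atTop (nhds 0) := by
    refine squeeze_zero' (g := fun t : ℝ => t⁻¹) ?_ ?_ tendsto_inv_atTop_zero
    · filter_upwards [Filter.eventually_gt_atTop 0] with t ht
      positivity
    · filter_upwards [Filter.eventually_gt_atTop 0] with t ht
      rw [div_le_iff₀ (by positivity)]
      have : t⁻¹ * (t ^ 2 + y ^ 2) = t + t⁻¹ * y ^ 2 := by field_simp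
      rw [this]
      have : 0 < t⁻¹ * y ^ 2 := by positivity
      linarith
  have h2 : Filter.Tendsto (fun t : ℝ => Real.arctan (t / y) / y) Filter.atTop
      (nhds (Real.pi / 2 / y)) := by
    refine Filter.Tendsto.div_const ?_ _
    exact (tendsto_nhds_of_tendsto_nhdsWithin Real.tendsto_arctan_atTop).comp
      (Filter.tendsto_id.atTop_div_const hy)
  have h3 := (h1.add h2).div_const 2
  have e : (0 + Real.pi / 2 / y) / 2 = Real.pi / (4 * y) := by field_simp; ring
  rw [e] at h3
  exact h3

/-- the basic bounds, for q ≥ 1 -/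
lemma HH_nonneg (p q : ℤ) (hq : 0 < q) : 0 ≤ HH p q := by
  have hy := hint_pos q hq
  unfold HH
  rw [sub_nonneg]
  apply Real.arctan_strictMono.monotone
  apply div_le_div_of_nonneg_right <;> linarith

lemma HH_eq (p q : ℤ) (hq : 0 < q) : ∃ η : ℝ, (p : ℝ) - 1 / 2 < η ∧ η < (p : ℝ) + 1 / 2 ∧
    HH p q = ((q : ℝ) - 1 / 2) / (η ^ 2 + ((q : ℝ) - 1 / 2) ^ 2) := by
  have hy := hint_pos q hq
  obtain ⟨η, h1, h2, h3⟩ := arctan_step ((q : ℝ) - 1 / 2) (by linarith) ((p : ℝ) - 1 / 2)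
  refine ⟨η, h1, by linarith, ?_⟩
  rw [← h3]
  unfold HH
  congr 3
  ring

lemma HH_le_inv (p q : ℤ) (hq : 0 < q) : HH p q ≤ 1 / ((q : ℝ) - 1 / 2) := by
  have hy := hint_pos q hq
  obtain ⟨η, h1, h2, h3⟩ := HH_eq p q hq
  rw [h3]
  set y := (q : ℝ) - 1 / 2
  rw [div_le_div_iff₀ (by positivity) (by positivity)]
  nlinarith [sq_nonneg η]

lemma HH_sq_le (p q : ℤ) (hq : 0 < q) (hp : 2 ≤ p) :
    (HH p q) ^ 2 ≤ GG ((q : ℝ) - 1 / 2) ((p : ℝ) - 1 / 2) -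
      GG ((q : ℝ) - 1 / 2) ((p : ℝ) - 1 - 1 / 2) := by
  have hy := hint_pos q hq
  have hp' : (2 : ℝ) ≤ p := by exact_mod_cast hp
  obtain ⟨η, h1, h2, h3⟩ := HH_eq p q hq
  rw [h3]
  set y := (q : ℝ) - 1 / 2
  have hy0 : 0 < y := by linarith
  obtain ⟨c, hc, h⟩ := exists_hasDerivAt_eq_slope (GG y)
    (fun t => y ^ 2 / (t ^ 2 + y ^ 2) ^ 2) (by linarith : (p : ℝ) - 1 - 1 / 2 < (p : ℝ) - 1 / 2)
    (fun t _ => (hasDerivAt_GG y hy0 t).continuousAt.continuousWithinAt)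
    (fun t _ => hasDerivAt_GG y hy0 t)
  have e : (p : ℝ) - 1 / 2 - ((p : ℝ) - 1 - 1 / 2) = 1 := by ring
  rw [e, div_one] at h
  rw [← h, div_pow]
  have : c ^ 2 ≤ η ^ 2 := by
    have := hc.1; have := hc.2
    apply pow_le_pow_left₀ <;> linarith
  gcongr

lemma HH_row_pos (q : ℤ) (hq : 0 < q) (m : ℕ) :
    ∑ p ∈ Finset.range m, (HH ((p : ℤ) + 2) q) ^ 2 ≤ Real.pi / (4 * ((q : ℝ) - 1 / 2)) := by
  have hy := hint_pos q hq
  have key : ∀ m : ℕ, ∑ p ∈ Finset.range m, (HH ((p : ℤ) + 2) q) ^ 2 ≤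
      GG ((q : ℝ) - 1 / 2) ((m : ℝ) + 1 / 2) - GG ((q : ℝ) - 1 / 2) (1 / 2) := by
    intro m
    induction m with
    | zero => simp
    | succ m ih =>
      rw [Finset.sum_range_succ]
      have := HH_sq_le ((m : ℤ) + 2) q hq (by omega)
      push_cast at this ⊢
      have e1 : (m : ℝ) + 2 - 1 / 2 = (m : ℝ) + 1 + 1 / 2 := by ring
      have e2 : (m : ℝ) + 2 - 1 - 1 / 2 = (m : ℝ) + 1 / 2 := by ring
      rw [e1, e2] at this
      linarith
  have h1 := key m
  have h2 := GG_le ((q : ℝ) - 1 / 2) (by linarith) ((m : ℝ) + 1 / 2)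
  have h3 : 0 ≤ GG ((q : ℝ) - 1 / 2) (1 / 2) := by
    unfold GG
    have : 0 ≤ Real.arctan (1 / 2 / ((q : ℝ) - 1 / 2)) := by
      rw [Real.arctan_nonneg]
      apply div_nonneg <;> linarith
    have : 0 ≤ (q : ℝ) - 1 / 2 := by linarith
    positivity
  linarith

lemma HH_row_nat (q : ℤ) (hq : 0 < q) (m : ℕ) :
    ∑ p ∈ Finset.range m, (HH ((p : ℤ) + 1) q) ^ 2 ≤
      Real.pi / (4 * ((q : ℝ) - 1 / 2)) + 1 / ((q : ℝ) - 1 / 2) ^ 2 := by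
  have hy := hint_pos q hq
  have hpp : (0 : ℝ) ≤ Real.pi / (4 * ((q : ℝ) - 1 / 2)) := by
    have := Real.pi_pos
    apply div_nonneg <;> linarith
  cases m with
  | zero =>
    rw [Finset.sum_range_zero]
    positivity
  | succ m =>
    rw [Finset.sum_range_succ']
    have h1 := HH_row_pos q hq m
    have h2 : (HH (((0 : ℕ) : ℤ) + 1) q) ^ 2 ≤ 1 / ((q : ℝ) - 1 / 2) ^ 2 := by
      have := pow_le_pow_left₀ (HH_nonneg (((0 : ℕ) : ℤ) + 1) q hq) (HH_le_inv _ q hq) 2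
      rwa [div_pow, one_pow] at this
    have h3 : ∀ p : ℕ, ((p + 1 : ℕ) : ℤ) + 1 = (p : ℤ) + 2 := by intro p; push_cast; ring
    simp only [h3]
    linarith

lemma sum_Icc_symm (f : ℤ → ℝ) (m : ℕ) :
    ∑ p ∈ Finset.Icc (-(m : ℤ)) m, f p =
      f 0 + ∑ p ∈ Finset.range m, (f ((p : ℤ) + 1) + f (-((p : ℤ) + 1))) := by
  induction m with
  | zero => simp
  | succ m ih =>
    rw [Finset.sum_range_succ, ← add_assoc, ← ih]
    have : Finset.Icc (-((m + 1 : ℕ) : ℤ)) ((m + 1 : ℕ) : ℤ) =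
        insert ((m : ℤ) + 1) (insert (-((m : ℤ) + 1)) (Finset.Icc (-(m : ℤ)) m)) := by
      ext a
      simp only [Finset.mem_Icc, Finset.mem_insert]
      push_cast
      omega
    rw [this, Finset.sum_insert, Finset.sum_insert]
    · ring
    · simp
    · simp only [Finset.mem_Icc, Finset.mem_insert]
      omega

lemma HH_row (q : ℤ) (hq : 0 < q) (m : ℕ) :
    ∑ p ∈ Finset.Icc (-(m : ℤ)) m, (HH p q) ^ 2 ≤
      Real.pi / (2 * ((q : ℝ) - 1 / 2)) + 3 / ((q : ℝ) - 1 / 2) ^ 2 := by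
  have hy := hint_pos q hq
  rw [sum_Icc_symm]
  simp only [HH_neg_p]
  rw [Finset.sum_add_distrib]
  have h1 := HH_row_nat q hq m
  have h2 : (HH 0 q) ^ 2 ≤ 1 / ((q : ℝ) - 1 / 2) ^ 2 := by
    have := pow_le_pow_left₀ (HH_nonneg 0 q hq) (HH_le_inv _ q hq) 2
    rwa [div_pow, one_pow] at this
  have e1 : Real.pi / (2 * ((q : ℝ) - 1 / 2)) = 2 * (Real.pi / (4 * ((q : ℝ) - 1 / 2))) := by
    field_simp; ring
  have e2 : 3 / ((q : ℝ) - 1 / 2) ^ 2 = 3 * (1 / ((q : ℝ) - 1 / 2) ^ 2) := by ring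
  rw [e1, e2]
  linarith

lemma sum_inv_sq_le (m : ℕ) : ∑ j ∈ Finset.range m, 1 / ((j : ℝ) + 1 / 2) ^ 2 ≤ 8 := by
  have key : ∀ m : ℕ, ∑ j ∈ Finset.range (m + 1), 1 / ((j : ℝ) + 1 / 2) ^ 2 ≤ 8 - 2 / ((m : ℝ) + 1 / 2) := by
    intro m
    induction m with
    | zero => simp; norm_num
    | succ m ih =>
      rw [Finset.sum_range_succ]
      have : 1 / (((m + 1 : ℕ) : ℝ) + 1 / 2) ^ 2 ≤ 2 / ((m : ℝ) + 1 / 2) - 2 / (((m + 1 : ℕ) : ℝ) + 1 / 2) := by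
        push_cast
        rw [div_sub_div _ _ (by positivity) (by positivity), div_le_div_iff₀ (by positivity) (by positivity)]
        have : (0 : ℝ) ≤ m := by positivity
        nlinarith [mul_nonneg this this]
      linarith
  cases m with
  | zero => simp
  | succ m =>
    have := key m
    have h : 0 ≤ 2 / ((m : ℝ) + 1 / 2) := by positivity
    linarith

lemma sum_inv_le (m : ℕ) :
    ∑ j ∈ Finset.range (m + 1), 1 / ((j : ℝ) + 1 / 2) ≤ 3 + Real.log m := by
  rw [Finset.sum_range_succ']
  have h1 : ∑ j ∈ Finset.range m, 1 / (((j + 1 : ℕ) : ℝ) + 1 / 2) ≤ (harmonic m : ℝ) := by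
    rw [harmonic]
    push_cast
    apply Finset.sum_le_sum
    intro i _
    rw [one_div]
    apply inv_anti₀ (by positivity)
    linarith
  have h2 := harmonic_le_one_add_log m
  simp only [Nat.cast_zero, zero_add]
  norm_num at *
  linarith

lemma HH_box (m : ℕ) :
    ∑ i ∈ Finset.Icc (-(m : ℤ)) m ×ˢ Finset.Icc (-(m : ℤ)) m, (HH i.1 i.2) ^ 2 ≤
      Real.pi * Real.log m + 100 := by
  rw [Finset.sum_product_right]
  simp only
  set g : ℤ → ℝ := fun q => ∑ p ∈ Finset.Icc (-(m : ℤ)) m, (HH p q) ^ 2 with hg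
  have hgneg : ∀ q, g (1 - q) = g q := by
    intro q; simp only [hg, HH_neg_q, neg_sq]
  have hg0 : ∀ q, 0 ≤ g q := fun q => Finset.sum_nonneg (fun _ _ => sq_nonneg _)
  have hrow : ∀ j : ℕ, g ((j : ℤ) + 1) ≤ Real.pi / 2 * (1 / ((j : ℝ) + 1 / 2)) + 3 * (1 / ((j : ℝ) + 1 / 2) ^ 2) := by
    intro j
    have := HH_row ((j : ℤ) + 1) (by omega) m
    have e : (((j : ℤ) + 1 : ℤ) : ℝ) - 1 / 2 = (j : ℝ) + 1 / 2 := by push_cast; ring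
    rw [e] at this
    refine this.trans (le_of_eq ?_)
    field_simp
  have hsum : ∑ q ∈ Finset.Icc (-(m : ℤ)) m, g q ≤
      2 * ∑ j ∈ Finset.range (m + 1), g ((j : ℤ) + 1) := by
    rw [sum_Icc_symm, Finset.sum_add_distrib, two_mul]
    have e1 : g 0 + ∑ p ∈ Finset.range m, g (-((p : ℤ) + 1)) = ∑ j ∈ Finset.range (m + 1), g ((j : ℤ) + 1) := by
      rw [Finset.sum_range_succ', add_comm]
      congr 1
      · apply Finset.sum_congr rfl
        intro p _
        rw [← hgneg]; congr 1; push_cast; ring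
      · rw [← hgneg]; congr 1
    have e2 : ∑ p ∈ Finset.range m, g ((p : ℤ) + 1) ≤ ∑ j ∈ Finset.range (m + 1), g ((j : ℤ) + 1) := by
      rw [Finset.sum_range_succ]
      linarith [hg0 ((m : ℤ) + 1)]
    linarith
  have h3 : ∑ j ∈ Finset.range (m + 1), g ((j : ℤ) + 1) ≤
      Real.pi / 2 * (3 + Real.log m) + 3 * 8 := by
    refine (Finset.sum_le_sum (fun j _ => hrow j)).trans ?_
    rw [Finset.sum_add_distrib, ← Finset.mul_sum, ← Finset.mul_sum]
    have := sum_inv_le m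
    have := sum_inv_sq_le (m + 1)
    have := Real.pi_pos
    gcongr
  have := Real.pi_lt_d2
  nlinarith

lemma HH_mul_x (p q : ℤ) (hq : 0 < q) : HH p q * |(p : ℝ) - 1 / 2| ≤ 3 / 2 := by
  have hy := hint_pos q hq
  have hpos : ∀ p : ℤ, 1 ≤ p → HH p q * ((p : ℝ) - 1 / 2) ≤ 1 / 2 := by
    intro p hp
    have hp' : (1 : ℝ) ≤ p := by exact_mod_cast hp
    obtain ⟨η, h1, h2, h3⟩ := HH_eq p q hq
    rw [h3]
    set y := (q : ℝ) - 1 / 2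
    rw [div_mul_eq_mul_div, div_le_div_iff₀ (by positivity) (by positivity)]
    nlinarith [sq_nonneg (η - y)]
  rcases lt_trichotomy p 0 with h | h | h
  · have h1 := hpos (-p) (by omega)
    rw [HH_neg_p] at h1
    have hp' : (p : ℝ) ≤ -1 := by exact_mod_cast (by omega : p ≤ -1)
    rw [abs_of_nonpos (by linarith)]
    push_cast at h1
    have := HH_nonneg p q hq
    nlinarith
  · subst h
    have h1 := HH_le_inv 0 q hq
    have h2 : 1 / ((q : ℝ) - 1 / 2) ≤ 2 := by
      rw [div_le_iff₀ (by linarith)]; linarith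
    have h3 : |((0 : ℤ) : ℝ) - 1 / 2| = 1 / 2 := by
      rw [abs_of_nonpos] <;> norm_num
    rw [h3]; linarith
  · have h1 := hpos p h
    have hp' : (1 : ℝ) ≤ p := by exact_mod_cast h
    rw [abs_of_nonneg (by linarith)]
    linarith

lemma HH_decay (p q : ℤ) : |HH p q| * (|(p : ℝ) - 1 / 2| + |(q : ℝ) - 1 / 2|) ≤ 4 := by
  have hpos : ∀ q : ℤ, 0 < q → |HH p q| * (|(p : ℝ) - 1 / 2| + |(q : ℝ) - 1 / 2|) ≤ 4 := by
    intro q hq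
    have hy := hint_pos q hq
    have h0 := HH_nonneg p q hq
    have h1 := HH_mul_x p q hq
    have h2 := HH_le_inv p q hq
    rw [le_div_iff₀ (by linarith)] at h2
    rw [abs_of_nonneg h0, abs_of_nonneg (by linarith : 0 ≤ (q : ℝ) - 1 / 2), mul_add]
    linarith
  by_cases hq : 0 < q
  · exact hpos q hq
  · have h := hpos (1 - q) (by omega)
    rw [HH_neg_q, abs_neg] at h
    have e : ((1 - q : ℤ) : ℝ) - 1 / 2 = -((q : ℝ) - 1 / 2) := by push_cast; ring
    rwa [e, abs_neg] at h

lemma HH_abs_le (p q : ℤ) : |HH p q| ≤ Real.pi / 2 := by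
  have hpos1 : ∀ p q : ℤ, 0 < q → 1 ≤ p → HH p q ≤ Real.pi / 2 := by
    intro p q hq hp
    have hp' : (1 : ℝ) ≤ p := by exact_mod_cast hp
    have hy := hint_pos q hq
    unfold HH
    have h1 := Real.arctan_lt_pi_div_two (((p : ℝ) + 1 / 2) / ((q : ℝ) - 1 / 2))
    have h2 : 0 ≤ Real.arctan (((p : ℝ) - 1 / 2) / ((q : ℝ) - 1 / 2)) := by
      rw [Real.arctan_nonneg]
      apply div_nonneg <;> linarith
    linarith
  have hpos : ∀ q : ℤ, 0 < q → |HH p q| ≤ Real.pi / 2 := by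
    intro q hq
    rw [abs_of_nonneg (HH_nonneg p q hq)]
    rcases lt_trichotomy p 0 with h | h | h
    · rw [← HH_neg_p]; exact hpos1 _ _ hq (by omega)
    · subst h
      have hy := hint_pos q hq
      unfold HH
      have e1 : (((0 : ℤ) : ℝ) + 1 / 2) / ((q : ℝ) - 1 / 2) = 1 / 2 / ((q : ℝ) - 1 / 2) := by simp
      have e2 : (((0 : ℤ) : ℝ) - 1 / 2) / ((q : ℝ) - 1 / 2) = -(1 / 2 / ((q : ℝ) - 1 / 2)) := by
        push_cast; ring
      rw [e1, e2, Real.arctan_neg]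
      have h1 : Real.arctan (1 / 2 / ((q : ℝ) - 1 / 2)) ≤ Real.arctan 1 := by
        apply Real.arctan_strictMono.monotone
        rw [div_le_one (by linarith)]; exact hy
      rw [Real.arctan_one] at h1
      linarith
    · exact hpos1 p q hq h
  by_cases hq : 0 < q
  · exact hpos q hq
  · have h := hpos (1 - q) (by omega)
    rwa [HH_neg_q, abs_neg] at h

noncomputable def vv (i : ℤ × ℤ) : ℝ :=
  -Real.arctan (((i.1 : ℝ) - 1 / 2) / ((i.2 : ℝ) - 1 / 2)) / (2 * Real.pi) +
    (if 0 < i.2 then 1 / 4 else -(1 / 4))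

def JJ (i : ℤ × ℤ) : ℤ := if i.1 ≤ 0 ∧ i.2 = 0 then 1 else 0

lemma vv_h (i : ℤ × ℤ) : vv (i + (1, 0)) - vv i = -HH i.1 i.2 / (2 * Real.pi) := by
  unfold vv HH
  simp only [Prod.fst_add, Prod.snd_add, add_zero]
  have e : ((i.1 + 1 : ℤ) : ℝ) - 1 / 2 = (i.1 : ℝ) + 1 / 2 := by push_cast; ring
  rw [e]
  ring

lemma vv_alt (i : ℤ × ℤ) : vv i =
    Real.arctan (((i.2 : ℝ) - 1 / 2) / ((i.1 : ℝ) - 1 / 2)) / (2 * Real.pi) +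
      (if 0 < i.1 then 0 else if 0 < i.2 then 1 / 2 else -(1 / 2)) := by
  obtain ⟨p, q⟩ := i
  unfold vv
  simp only
  have hpi := Real.pi_pos
  have e : ((q : ℝ) - 1 / 2) / ((p : ℝ) - 1 / 2) = (((p : ℝ) - 1 / 2) / ((q : ℝ) - 1 / 2))⁻¹ := by
    rw [inv_div]
  rw [e]
  by_cases hp : 0 < p <;> by_cases hq : 0 < q <;> simp only [hp, hq, if_true, if_false]
  · have h1 := hint_pos p hp
    have h2 := hint_pos q hq
    rw [Real.arctan_inv_of_pos (div_pos (by linarith) (by linarith))]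
    field_simp; ring
  · have h1 := hint_pos p hp
    have h2 := hint_neg q hq
    rw [Real.arctan_inv_of_neg (div_neg_of_pos_of_neg (by linarith) (by linarith))]
    field_simp; ring
  · have h1 := hint_neg p hp
    have h2 := hint_pos q hq
    rw [Real.arctan_inv_of_neg (div_neg_of_neg_of_pos (by linarith) (by linarith))]
    field_simp; ring
  · have h1 := hint_neg p hp
    have h2 := hint_neg q hq
    rw [Real.arctan_inv_of_pos (div_pos_of_neg_of_neg (by linarith) (by linarith))]
    field_simp; ring

lemma vv_v (i : ℤ × ℤ) : vv (i + (0, 1)) - vv i = HH i.2 i.1 / (2 * Real.pi) + JJ i := by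
  rw [vv_alt, vv_alt]
  obtain ⟨p, q⟩ := i
  unfold HH JJ
  simp only [Prod.fst_add, Prod.snd_add, add_zero]
  have e : ((q + 1 : ℤ) : ℝ) - 1 / 2 = (q : ℝ) + 1 / 2 := by push_cast; ring
  rw [e]
  have key : ((if 0 < p then 0 else if 0 < q + 1 then 1 / 2 else -(1 / 2)) : ℝ) -
      (if 0 < p then 0 else if 0 < q then 1 / 2 else -(1 / 2)) =
      ((if p ≤ 0 ∧ q = 0 then 1 else 0 : ℤ) : ℝ) := by
    by_cases hp : 0 < p
    · rw [if_pos hp, if_pos hp, if_neg (by omega)]; simp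
    · rw [if_neg hp, if_neg hp]
      rcases lt_trichotomy q 0 with h | h | h
      · rw [if_neg (by omega), if_neg (by omega), if_neg (by omega)]; simp
      · rw [if_pos (by omega), if_neg (by omega), if_pos (by omega)]; norm_num
      · rw [if_pos (by omega), if_pos (by omega), if_neg (by omega)]; simp
  rw [← key]
  ring

lemma elast_eq (t : ℝ) (n : ℤ) (h : |t - n| < 1 / 2) : elast t = t - n := by
  unfold elast
  rw [abs_lt] at h
  have : ⌈t - 1 / 2⌉ = n := by
    rw [Int.ceil_eq_iff]
    constructor <;> linarith
  rw [this]

lemma distZ_le (t : ℝ) (n : ℤ) : distZ t ≤ |t - n| := by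
  unfold distZ
  exact ciInf_le ⟨0, by rintro _ ⟨n, rfl⟩; exact abs_nonneg _⟩ n

lemma distZ_nonneg (t : ℝ) : 0 ≤ distZ t := Real.iInf_nonneg (fun _ => abs_nonneg _)

lemma f1_le (t : ℝ) (n : ℤ) : f1 t ≤ 2 * Real.pi ^ 2 * (t - n) ^ 2 := by
  unfold f1
  rw [← sq_abs (t - n)]
  have := distZ_le t n
  have := distZ_nonneg t
  gcongr

lemma small_signed_sum {K : Type*} [Fintype K] (s : K → ℤ) (hs : ∀ k, |s k| = 1) (a : K → ℝ)
    (η : ℝ) (hη : 0 ≤ η) (ha : ∀ k, |a k| ≤ 1 / 4) (hpair : ∀ k l, k ≠ l → |a k| ≤ η ∨ |a l| ≤ η)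
    (hM : (Fintype.card K : ℝ) * η < 1 / 4) : |∑ k, (s k : ℝ) * a k| < 1 / 2 := by
  have h1 : |∑ k, (s k : ℝ) * a k| ≤ ∑ k, |a k| := by
    refine (Finset.abs_sum_le_sum_abs _ _).trans (le_of_eq ?_)
    refine Finset.sum_congr rfl (fun k _ => ?_)
    rw [abs_mul, ← Int.cast_abs, hs]; simp
  refine h1.trans_lt ?_
  by_cases hall : ∀ k, |a k| ≤ η
  · have : ∑ k, |a k| ≤ ∑ _k : K, η := Finset.sum_le_sum (fun k _ => hall k)
    simp at this
    linarith
  · push Not at hall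
    obtain ⟨k0, hk0⟩ := hall
    have h2 : ∀ k, |a k| ≤ η + if k = k0 then 1 / 4 else 0 := by
      intro k
      by_cases hk : k = k0
      · subst hk; rw [if_pos rfl]; linarith [ha k]
      · rw [if_neg hk]
        rcases hpair k k0 hk with h | h <;> linarith
    have := Finset.sum_le_sum (fun k (_ : k ∈ Finset.univ) => h2 k)
    rw [Finset.sum_add_distrib] at this
    simp at this
    linarith

lemma quad_sum {K : Type*} [Fintype K] (s : K → ℤ) (hs : ∀ k, |s k| = 1) (a : K → ℝ)
    (η δ : ℝ) (hδ : 0 < δ) (hpair : ∀ k l, k ≠ l → |a k| ≤ η ∨ |a l| ≤ η) :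
    (∑ k, (s k : ℝ) * a k) ^ 2 ≤ (1 + Fintype.card K * δ) * ∑ k, (a k) ^ 2 +
      (Fintype.card K : ℝ) ^ 2 * (η ^ 2 / δ) := by
  have h1 : |∑ k, (s k : ℝ) * a k| ≤ ∑ k, |a k| := by
    refine (Finset.abs_sum_le_sum_abs _ _).trans (le_of_eq ?_)
    refine Finset.sum_congr rfl (fun k _ => ?_)
    rw [abs_mul, ← Int.cast_abs, hs]; simp
  have h2 : (∑ k, (s k : ℝ) * a k) ^ 2 ≤ (∑ k, |a k|) ^ 2 := by
    rw [← sq_abs]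
    exact pow_le_pow_left₀ (abs_nonneg _) h1 2
  refine h2.trans ?_
  rw [sq, Finset.sum_mul_sum]
  have hp : ∀ k l, |a k| * |a l| ≤ (if k = l then (a k) ^ 2 else 0) +
      δ / 2 * ((a k) ^ 2 + (a l) ^ 2) + η ^ 2 / δ := by
    intro k l
    have hη : 0 ≤ η ^ 2 / δ := by positivity
    by_cases hkl : k = l
    · subst hkl
      rw [if_pos rfl, ← sq, sq_abs]
      have : 0 ≤ δ / 2 * ((a k) ^ 2 + (a k) ^ 2) := by positivity
      linarith
    · rw [if_neg hkl]
      have gen : ∀ x y : ℝ, 0 ≤ x → 0 ≤ y → y ≤ η → x * y ≤ δ / 2 * x ^ 2 + η ^ 2 / δ := by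
        intro x y hx hy hyη
        have e : δ / 2 * x ^ 2 + η ^ 2 / δ - x * η = ((δ * x - η) ^ 2 + η ^ 2) / (2 * δ) := by
          field_simp; ring
        have e2 : 0 ≤ ((δ * x - η) ^ 2 + η ^ 2) / (2 * δ) := by positivity
        have := mul_le_mul_of_nonneg_left hyη hx
        linarith
      have n1 : 0 ≤ δ / 2 * (a k) ^ 2 := by positivity
      have n2 : 0 ≤ δ / 2 * (a l) ^ 2 := by positivity
      rcases hpair k l hkl with h | h
      · have := gen |a l| |a k| (abs_nonneg _) (abs_nonneg _) h
        rw [sq_abs] at this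
        nlinarith
      · have := gen |a k| |a l| (abs_nonneg _) (abs_nonneg _) h
        rw [sq_abs] at this
        nlinarith
  refine (Finset.sum_le_sum fun k _ => Finset.sum_le_sum fun l _ => hp k l).trans ?_
  simp only [Finset.sum_add_distrib, ← Finset.mul_sum, Finset.sum_ite_eq, Finset.mem_univ, if_true,
    Finset.sum_const, Finset.card_univ, nsmul_eq_mul]
  apply le_of_eq
  ring

noncomputable def uu {K : Type*} [Fintype K] (s : K → ℤ) (c : K → ℤ × ℤ) (i : ℤ × ℤ) : ℝ :=
  ∑ k, (s k : ℝ) * vv (i - c k)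

lemma uu_h {K : Type*} [Fintype K] (s : K → ℤ) (c : K → ℤ × ℤ) (i : ℤ × ℤ) :
    uu s c (i + (1, 0)) - uu s c i =
      ∑ k, (s k : ℝ) * (-HH (i - c k).1 (i - c k).2 / (2 * Real.pi)) := by
  unfold uu
  rw [← Finset.sum_sub_distrib]
  refine Finset.sum_congr rfl fun k _ => ?_
  rw [← vv_h, ← mul_sub, add_sub_right_comm]

lemma uu_v {K : Type*} [Fintype K] (s : K → ℤ) (c : K → ℤ × ℤ) (i : ℤ × ℤ) :
    uu s c (i + (0, 1)) - uu s c i =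
      ∑ k, (s k : ℝ) * (HH (i - c k).2 (i - c k).1 / (2 * Real.pi)) +
        ((∑ k, s k * JJ (i - c k) : ℤ) : ℝ) := by
  unfold uu
  push_cast
  rw [← Finset.sum_sub_distrib, ← Finset.sum_add_distrib]
  refine Finset.sum_congr rfl fun k _ => ?_
  rw [← mul_add, ← vv_v, ← mul_sub, add_sub_right_comm]

/-- separation -/
lemma HH_pair {K : Type*} (c : K → ℤ × ℤ) (D : ℝ) (hD : 0 < D)
    (hsep : ∀ k l, k ≠ l → D ≤ |((c k).1 : ℝ) - (c l).1| + |((c k).2 : ℝ) - (c l).2|)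
    (i : ℤ × ℤ) (k l : K) (hkl : k ≠ l) :
    (|HH (i - c k).1 (i - c k).2| ≤ 8 / D ∧ |HH (i - c k).2 (i - c k).1| ≤ 8 / D) ∨
    (|HH (i - c l).1 (i - c l).2| ≤ 8 / D ∧ |HH (i - c l).2 (i - c l).1| ≤ 8 / D) := by
  have far : ∀ p q : ℤ, D / 2 ≤ |(p : ℝ) - 1 / 2| + |(q : ℝ) - 1 / 2| →
      |HH p q| ≤ 8 / D ∧ |HH q p| ≤ 8 / D := by
    intro p q h
    have h1 := HH_decay p q
    have h2 := HH_decay q p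
    have n1 := abs_nonneg (HH p q)
    have n2 := abs_nonneg (HH q p)
    rw [le_div_iff₀ hD, le_div_iff₀ hD]
    constructor <;> nlinarith
  have hs := hsep k l hkl
  by_cases hk : D / 2 ≤ |((i - c k).1 : ℝ) - 1 / 2| + |((i - c k).2 : ℝ) - 1 / 2|
  · exact Or.inl (far _ _ hk)
  · right
    apply far
    push Not at hk
    have t1 : |((c k).1 : ℝ) - (c l).1| ≤ |((i - c k).1 : ℝ) - 1 / 2| + |((i - c l).1 : ℝ) - 1 / 2| := by
      have e : ((c k).1 : ℝ) - (c l).1 = (((i - c l).1 : ℝ) - 1 / 2) - (((i - c k).1 : ℝ) - 1 / 2) := by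
        simp only [Prod.fst_sub]; push_cast; ring
      rw [e, add_comm]; exact abs_sub _ _
    have t2 : |((c k).2 : ℝ) - (c l).2| ≤ |((i - c k).2 : ℝ) - 1 / 2| + |((i - c l).2 : ℝ) - 1 / 2| := by
      have e : ((c k).2 : ℝ) - (c l).2 = (((i - c l).2 : ℝ) - 1 / 2) - (((i - c k).2 : ℝ) - 1 / 2) := by
        simp only [Prod.snd_sub]; push_cast; ring
      rw [e, add_comm]; exact abs_sub _ _
    linarith

lemma abs_div_two_pi (a b : ℝ) (h : |a| ≤ b) : |a / (2 * Real.pi)| ≤ b / (2 * Real.pi) := by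
  have := Real.pi_pos
  rw [abs_div, abs_of_pos (by positivity : 0 < 2 * Real.pi)]
  gcongr

lemma mCirc_uu {K : Type*} [Fintype K] (s : K → ℤ) (hs : ∀ k, |s k| = 1) (c : K → ℤ × ℤ)
    (D : ℝ) (hD : 0 < D)
    (hsep : ∀ k l, k ≠ l → D ≤ |((c k).1 : ℝ) - (c l).1| + |((c k).2 : ℝ) - (c l).2|)
    (hM : (Fintype.card K : ℝ) * (8 / D) < 1 / 4) (i : ℤ × ℤ) :
    mCirc (uu s c) i = ∑ k, if i = c k then (s k : ℝ) else 0 := by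
  have hpi := Real.pi_gt_three
  have hη : 0 ≤ 8 / D := by positivity
  have q4 : ∀ p q : ℤ, |HH p q / (2 * Real.pi)| ≤ 1 / 4 := by
    intro p q
    refine (abs_div_two_pi _ _ (HH_abs_le p q)).trans (le_of_eq ?_)
    field_simp; ring
  have qη : ∀ a : ℝ, |a| ≤ 8 / D → |a / (2 * Real.pi)| ≤ 8 / D := by
    intro a ha
    refine (abs_div_two_pi _ _ ha).trans ?_
    apply div_le_self hη; linarith
  have eh : ∀ i, elast (uu s c (i + (1, 0)) - uu s c i) =
      ∑ k, (s k : ℝ) * (-HH (i - c k).1 (i - c k).2 / (2 * Real.pi)) := by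
    intro i
    rw [uu_h, elast_eq _ 0]
    · simp
    · rw [Int.cast_zero, sub_zero]
      refine small_signed_sum s hs _ (8 / D) hη ?_ ?_ hM
      · intro k; rw [neg_div, abs_neg]; exact q4 _ _
      · intro k l hkl
        rw [neg_div, abs_neg, neg_div, abs_neg]
        exact (HH_pair c D hD hsep i k l hkl).imp (fun h => qη _ h.1) (fun h => qη _ h.1)
  have ev : ∀ i, elast (uu s c (i + (0, 1)) - uu s c i) =
      ∑ k, (s k : ℝ) * (HH (i - c k).2 (i - c k).1 / (2 * Real.pi)) := by
    intro i
    rw [uu_v, elast_eq _ (∑ k, s k * JJ (i - c k))]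
    · ring
    · rw [add_sub_cancel_right]
      refine small_signed_sum s hs _ (8 / D) hη ?_ ?_ hM
      · intro k; exact q4 _ _
      · intro k l hkl
        exact (HH_pair c D hD hsep i k l hkl).imp (fun h => qη _ h.2) (fun h => qη _ h.2)
  unfold mCirc
  have e1 : i + (1, 1) = (i + (1, 0)) + (0, 1) := by ext <;> simp
  have e2 : i + (1, 1) = (i + (0, 1)) + (1, 0) := by ext <;> simp
  rw [eh i, ev i]
  nth_rewrite 1 [e1]
  rw [ev, e2, eh, ← Finset.sum_add_distrib, ← Finset.sum_sub_distrib, ← Finset.sum_sub_distrib]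
  refine Finset.sum_congr rfl fun k _ => ?_
  have a1 : i + (1, 0) - c k = (i - c k) + (1, 0) := add_sub_right_comm _ _ _
  have a2 : i + (0, 1) - c k = (i - c k) + (0, 1) := add_sub_right_comm _ _ _
  rw [a1, a2]
  have hic : i = c k ↔ i - c k = 0 := sub_eq_zero.symm
  rw [show (if i = c k then (s k : ℝ) else 0) = s k * (if i - c k = 0 then 1 else 0) by
    simp [hic]]
  generalize i - c k = j
  have v1 := vv_h j
  have v2 := vv_h (j + (0, 1))
  have v3 := vv_v j
  have v4 := vv_v (j + (1, 0))
  have e3 : j + (1, 0) + (0, 1) = j + (0, 1) + (1, 0) := add_right_comm _ _ _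
  rw [e3] at v4
  have hJ : (JJ j : ℝ) - JJ (j + (1, 0)) = if j = 0 then 1 else 0 := by
    obtain ⟨p, q⟩ := j
    unfold JJ
    simp only [Prod.fst_add, Prod.snd_add, add_zero, Prod.mk_eq_zero]
    by_cases h1 : q = 0
    · subst h1
      rcases lt_trichotomy p 0 with h | h | h
      · rw [if_pos (by omega), if_pos (by omega), if_neg (by omega)]; simp
      · rw [if_pos (by omega), if_neg (by omega), if_pos (by omega)]; simp
      · rw [if_neg (by omega), if_neg (by omega), if_neg (by omega)]; simp
    · rw [if_neg (by omega), if_neg (by omega), if_neg (by omega)]; simp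
  rw [← hJ, ← mul_add, ← mul_sub, ← mul_sub]
  congr 1
  linarith

lemma tsum_seg_le (f : ℤ × ℤ → ℝ) (T : Set (ℤ × ℤ)) (S : Finset (ℤ × ℤ)) (hT : T ⊆ S)
    (hf : ∀ i ∈ S, 0 ≤ f i) :
    ∑' i : T, ENNReal.ofReal (f i) ≤ ENNReal.ofReal (∑ i ∈ S, f i) := by
  rw [ENNReal.ofReal_sum_of_nonneg hf, ← Finset.tsum_subtype S (fun i => ENNReal.ofReal (f i))]
  exact ENNReal.tsum_mono_subtype (fun i => ENNReal.ofReal (f i)) hT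

noncomputable def box (n : ℕ) : Finset (ℤ × ℤ) := Finset.Icc (-(n : ℤ)) n ×ˢ Finset.Icc (-(n : ℤ)) n

lemma mem_box (n : ℕ) (i : ℤ × ℤ) : i ∈ box n ↔ |i.1| ≤ n ∧ |i.2| ≤ n := by
  unfold box
  rw [Finset.mem_product, Finset.mem_Icc, Finset.mem_Icc, abs_le, abs_le]

lemma box_card (n : ℕ) : ((box n).card : ℝ) = (2 * n + 1) ^ 2 := by
  unfold box
  rw [Finset.card_product, Int.card_Icc]
  have : ((n : ℤ) + 1 - -(n : ℤ)).toNat = 2 * n + 1 := by omega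
  rw [this]; push_cast; ring

lemma HH_box_shift (n : ℕ) (c : ℤ × ℤ) (hc : c ∈ box (n + 1)) :
    ∑ i ∈ box n, (HH (i - c).1 (i - c).2) ^ 2 ≤ Real.pi * Real.log ((2 * n + 1 : ℕ) : ℝ) + 100 := by
  refine le_trans ?_ (HH_box (2 * n + 1))
  rw [← Finset.sum_image (s := box n) (g := fun i => i - c) (f := fun j => (HH j.1 j.2) ^ 2)
    (fun a _ b _ h => sub_left_injective h)]
  refine Finset.sum_le_sum_of_subset_of_nonneg ?_ (fun _ _ _ => sq_nonneg _)
  intro j hj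
  rw [Finset.mem_image] at hj
  obtain ⟨i, hi, rfl⟩ := hj
  change i - c ∈ box (2 * n + 1)
  rw [mem_box] at *
  simp only [abs_le, Prod.fst_sub, Prod.snd_sub] at *
  push_cast at *
  omega

lemma HH_box_shift' (n : ℕ) (c : ℤ × ℤ) (hc : c ∈ box (n + 1)) :
    ∑ i ∈ box n, (HH (i - c).2 (i - c).1) ^ 2 ≤ Real.pi * Real.log ((2 * n + 1 : ℕ) : ℝ) + 100 := by
  refine le_trans (le_of_eq ?_) (HH_box_shift n c.swap ?_)
  · refine Finset.sum_bij (fun i _ => i.swap) ?_ ?_ ?_ ?_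
    · intro i hi; rw [mem_box] at *; exact ⟨hi.2, hi.1⟩
    · intro a _ b _ h; exact Prod.swap_injective h
    · intro b hb; refine ⟨b.swap, ?_, Prod.swap_swap b⟩
      rw [mem_box] at *; exact ⟨hb.2, hb.1⟩
    · intro i _; rfl
  · rw [mem_box] at *; exact ⟨hc.2, hc.1⟩

lemma energy_le {K : Type*} [Fintype K] (s : K → ℤ) (hs : ∀ k, |s k| = 1) (c : K → ℤ × ℤ)
    (D : ℝ) (hD : 0 < D)
    (hsep : ∀ k l, k ≠ l → D ≤ |((c k).1 : ℝ) - (c l).1| + |((c k).2 : ℝ) - (c l).2|)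
    (δ : ℝ) (hδ : 0 < δ) (ε : ℝ) (Ω : Set Plane) (n : ℕ)
    (hbox : ∀ i, ε • toPlane i ∈ Ω → i ∈ box n) (hc : ∀ k, c k ∈ box (n + 1)) :
    Fedge ε (uu s c) Ω ≤ ENNReal.ofReal (
      (1 + Fintype.card K * δ) * (Fintype.card K * (Real.pi * Real.log ((2 * n + 1 : ℕ) : ℝ) + 100))
       + (2 * n + 1) ^ 2 * ((Fintype.card K : ℝ) ^ 2 * ((8 / D) ^ 2 / δ))) := by
  have hpi := Real.pi_pos
  have hsub : ∀ e, latticeSeg ε e Ω ⊆ box n := by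
    intro e i hi
    exact hbox i (hi (left_mem_segment ℝ _ _))
  set M : ℝ := (Fintype.card K : ℝ) with hM
  have hM0 : 0 ≤ M := by positivity
  set B : ℝ := (1 + M * δ) * (M * (Real.pi * Real.log ((2 * n + 1 : ℕ) : ℝ) + 100))
       + (2 * n + 1) ^ 2 * (M ^ 2 * ((8 / D) ^ 2 / δ)) with hB
  have total : ∀ a : K → ℤ × ℤ → ℝ,
      (∀ i k l, k ≠ l → |a k i| ≤ 8 / D ∨ |a l i| ≤ 8 / D) →
      (∀ k, ∑ i ∈ box n, (a k i) ^ 2 ≤ Real.pi * Real.log ((2 * n + 1 : ℕ) : ℝ) + 100) →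
      ∑ i ∈ box n, 1 / 2 * (∑ k, (s k : ℝ) * a k i) ^ 2 ≤ B / 2 := by
    intro a h1 h2
    rw [← Finset.mul_sum]
    have h3 : ∑ i ∈ box n, (∑ k, (s k : ℝ) * a k i) ^ 2 ≤ B := by
      refine (Finset.sum_le_sum fun i _ => quad_sum s hs (fun k => a k i) (8 / D) δ hδ (h1 i)).trans ?_
      rw [Finset.sum_add_distrib, ← Finset.mul_sum, Finset.sum_comm, Finset.sum_const, nsmul_eq_mul,
        box_card, hB]
      have h4 : ∑ k, ∑ i ∈ box n, (a k i) ^ 2 ≤ M * (Real.pi * Real.log ((2 * n + 1 : ℕ) : ℝ) + 100) := by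
        refine (Finset.sum_le_sum fun k _ => h2 k).trans (le_of_eq ?_)
        rw [Finset.sum_const, nsmul_eq_mul, Finset.card_univ]
      have := mul_le_mul_of_nonneg_left h4 (by positivity : 0 ≤ 1 + M * δ)
      linarith
    linarith
  have hH : ∑ i ∈ box n, f0 (uu s c (i + (1, 0)) - uu s c i) ≤ B / 2 := by
    refine le_trans (le_of_eq ?_) (total (fun k i => HH (i - c k).1 (i - c k).2)
      (fun i k l hkl => (HH_pair c D hD hsep i k l hkl).imp (fun h => h.1) (fun h => h.1))
      (fun k => HH_box_shift n (c k) (hc k)))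
    refine Finset.sum_congr rfl fun i _ => ?_
    have e : ∑ k, (s k : ℝ) * (-HH (i - c k).1 (i - c k).2 / (2 * Real.pi)) =
        -(∑ k, (s k : ℝ) * HH (i - c k).1 (i - c k).2) / (2 * Real.pi) := by
      rw [← Finset.sum_neg_distrib, Finset.sum_div]
      exact Finset.sum_congr rfl fun k _ => by ring
    rw [uu_h, f0, e]
    field_simp
  have hV : ∑ i ∈ box n, f1 (uu s c (i + (0, 1)) - uu s c i) ≤ B / 2 := by
    refine le_trans ?_ (total (fun k i => HH (i - c k).2 (i - c k).1)
      (fun i k l hkl => (HH_pair c D hD hsep i k l hkl).imp (fun h => h.2) (fun h => h.2))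
      (fun k => HH_box_shift' n (c k) (hc k)))
    refine Finset.sum_le_sum fun i _ => ?_
    refine (f1_le _ (∑ k, s k * JJ (i - c k))).trans (le_of_eq ?_)
    have e : ∑ k, (s k : ℝ) * (HH (i - c k).2 (i - c k).1 / (2 * Real.pi)) =
        (∑ k, (s k : ℝ) * HH (i - c k).2 (i - c k).1) / (2 * Real.pi) := by
      rw [Finset.sum_div]
      exact Finset.sum_congr rfl fun k _ => by ring
    rw [uu_v, add_sub_cancel_right, e]
    field_simp
  have n0 : ∀ t, 0 ≤ f0 t := fun t => by unfold f0; positivity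
  have n1 : ∀ t, 0 ≤ f1 t := fun t => by unfold f1; positivity
  have t1 := tsum_seg_le (fun i => f0 (uu s c (i + (1, 0)) - uu s c i)) _ _ (hsub (1, 0)) (fun _ _ => n0 _)
  have t2 := tsum_seg_le (fun i => f1 (uu s c (i + (0, 1)) - uu s c i)) _ _ (hsub (0, 1)) (fun _ _ => n1 _)
  unfold Fedge
  refine (add_le_add t1 t2).trans ?_
  rw [← ENNReal.ofReal_add (Finset.sum_nonneg fun _ _ => n0 _) (Finset.sum_nonneg fun _ _ => n1 _)]
  apply ENNReal.ofReal_le_ofReal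
  linarith

lemma center_inj (ε : ℝ) (hε : 0 < ε) : Function.Injective (center ε) := by
  intro i j h
  have h0 := congrArg (fun p : Plane => p 0) h
  have h1 := congrArg (fun p : Plane => p 1) h
  simp [center] at h0 h1
  ext
  · exact_mod_cast h0.resolve_right hε.ne'
  · exact_mod_cast h1.resolve_right hε.ne'

lemma vortMeas_eq {K : Type*} [Fintype K] (s : K → ℤ) (c : K → ℤ × ℤ) (u : ℤ × ℤ → ℝ)
    (hu : ∀ i, mCirc u i = ∑ k, if i = c k then (s k : ℝ) else 0) (ε : ℝ)
    (Ω : Set Plane) (hc : ∀ k, center ε (c k) ∈ Ω) (p : Plane) :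
    vortMeas ε u Ω p = ∑ k, if center ε (c k) = p then (s k : ℝ) else 0 := by
  unfold vortMeas
  have h1 : ∀ i, (∑ᶠ (_ : center ε i = p ∧ center ε i ∈ Ω), mCirc u i) =
      ∑ k, if i = c k then (if center ε (c k) = p then (s k : ℝ) else 0) else 0 := by
    intro i
    by_cases hi : center ε i = p ∧ center ε i ∈ Ω
    · rw [finsum_eq_if, if_pos hi, hu]
      refine Finset.sum_congr rfl fun k _ => ?_
      by_cases hk : i = c k
      · subst hk; simp [hi.1]
      · simp [hk]
    · rw [finsum_eq_if, if_neg hi]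
      symm
      refine Finset.sum_eq_zero fun k _ => ?_
      by_cases hk : i = c k
      · subst hk
        have : ¬ center ε (c k) = p := fun h => hi ⟨h, hc k⟩
        simp [this]
      · simp [hk]
  simp only [h1]
  rw [finsum_sum_comm]
  · refine Finset.sum_congr rfl fun k _ => ?_
    rw [finsum_eq_single _ (c k)]
    · simp
    · intro i hi; simp [hi]
  · intro k _
    refine (Set.finite_singleton (c k)).subset ?_
    intro i hi
    by_contra hne
    apply hi
    simp at hne
    simp [hne]

lemma finsum_dirac {K : Type*} [Fintype K] (w : K → ℝ) (y : K → Plane) (ψ : Plane → ℝ) :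
    (Function.support fun p => (∑ k, if y k = p then w k else 0) * ψ p).Finite ∧
    ∑ᶠ p, (∑ k, if y k = p then w k else 0) * ψ p = ∑ k, w k * ψ (y k) := by
  have hsupp : ∀ k, (Function.support fun p => (if y k = p then w k else 0) * ψ p).Finite := by
    intro k
    refine (Set.finite_singleton (y k)).subset ?_
    intro p hp
    by_contra hne
    apply hp
    simp at hne
    simp [Ne.symm hne]
  simp only [Finset.sum_mul]
  constructor
  · refine (Set.finite_iUnion hsupp).subset ?_
    intro p hp
    by_contra hne
    apply hp
    simp only [Set.mem_iUnion, not_exists, Function.mem_support, not_not] at hne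
    exact Finset.sum_eq_zero fun k _ => hne k
  · rw [finsum_sum_comm _ _ (fun k _ => hsupp k)]
    refine Finset.sum_congr rfl fun k _ => ?_
    rw [finsum_eq_single _ (y k)]
    · simp
    · intro p hp; simp [Ne.symm hp]

lemma flat_le {K : Type*} [Fintype K] (s : K → ℤ) (hs : ∀ k, |s k| = 1) (y z : K → Plane)
    (Ω : Set Plane) :
    0 ≤ flatNorm Ω (fun p => (∑ k, if y k = p then (s k : ℝ) else 0) -
      ∑ k, if z k = p then (s k : ℝ) else 0) ∧
    flatNorm Ω (fun p => (∑ k, if y k = p then (s k : ℝ) else 0) -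
      ∑ k, if z k = p then (s k : ℝ) else 0) ≤ ∑ k, dist (y k) (z k) := by
  unfold flatNorm
  set T : Set ℝ := {r : ℝ | ∃ ψ : Plane → ℝ, ContDiff ℝ (⊤ : ℕ∞) ψ ∧ HasCompactSupport ψ ∧ tsupport ψ ⊆ Ω ∧
    (∀ p, |ψ p| ≤ 1) ∧ (∀ p, ‖fderiv ℝ ψ p‖ ≤ 1) ∧ r = ∑ᶠ p, ((∑ k, if y k = p then (s k : ℝ) else 0) -
      ∑ k, if z k = p then (s k : ℝ) else 0) * ψ p} with hT
  have hub : ∀ r ∈ T, r ≤ ∑ k, dist (y k) (z k) := by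
    rintro r ⟨ψ, h1, h2, h3, h4, h5, rfl⟩
    obtain ⟨fy, ey⟩ := finsum_dirac (fun k => (s k : ℝ)) y ψ
    obtain ⟨fz, ez⟩ := finsum_dirac (fun k => (s k : ℝ)) z ψ
    simp only [sub_mul]
    rw [finsum_sub_distrib fy fz, ey, ez, ← Finset.sum_sub_distrib]
    refine Finset.sum_le_sum fun k _ => ?_
    rw [← mul_sub]
    refine (le_abs_self _).trans ?_
    rw [abs_mul, ← Int.cast_abs, hs, Int.cast_one, one_mul]
    have := Convex.norm_image_sub_le_of_norm_fderiv_le (𝕜 := ℝ) (f := ψ) (C := 1) (s := Set.univ)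
      (fun x _ => (h1.differentiable (by simp)) x) (fun x _ => h5 x) convex_univ
      (Set.mem_univ (z k)) (Set.mem_univ (y k))
    rw [one_mul, Real.norm_eq_abs] at this
    rw [dist_eq_norm]
    exact this
  have h0 : (0 : ℝ) ∈ T := by
    refine ⟨fun _ => 0, contDiff_const, HasCompactSupport.zero, ?_, ?_, ?_, ?_⟩
    · simp [tsupport]
    · simp
    · simp
    · simp
  exact ⟨le_csSup ⟨_, hub⟩ h0, csSup_le ⟨0, h0⟩ hub⟩

lemma plane_dist_le (p q : Plane) : dist p q ≤ |p 0 - q 0| + |p 1 - q 1| := by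
  rw [EuclideanSpace.dist_eq, Fin.sum_univ_two, Real.dist_eq, Real.dist_eq]
  apply Real.sqrt_le_iff.mpr
  constructor
  · positivity
  · nlinarith [mul_nonneg (abs_nonneg (p 0 - q 0)) (abs_nonneg (p 1 - q 1))]

lemma plane_abs_le (p : Plane) (j : Fin 2) : |p j| ≤ ‖p‖ := by
  have := PiLp.norm_apply_le p j
  simpa using this

noncomputable def LL (ε : ℝ) : ℝ := |Real.log ε|

noncomputable def rr (ε : ℝ) : ℝ := √(√(1 / LL ε))

noncomputable def FF : Filter ℝ := nhdsWithin 0 (Set.Ioo (0 : ℝ) 1)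

instance : FF.NeBot := by
  unfold FF
  rw [nhdsWithin_Ioo_eq_nhdsGT (by norm_num : (0 : ℝ) < 1)]
  infer_instance

lemma FF_le : FF ≤ nhdsWithin 0 (Set.Ioi 0) :=
  nhdsWithin_mono _ (fun _ h => h.1)

lemma FF_mem : ∀ᶠ ε in FF, 0 < ε ∧ ε < 1 := eventually_mem_nhdsWithin

lemma FF_id : Filter.Tendsto (fun ε : ℝ => ε) FF (nhds 0) :=
  Filter.tendsto_id'.mpr (nhdsWithin_le_nhds)

lemma LL_tendsto : Filter.Tendsto LL FF Filter.atTop :=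
  Filter.tendsto_abs_atBot_atTop.comp (Real.tendsto_log_nhdsGT_zero.mono_left FF_le)

lemma rr_tendsto : Filter.Tendsto rr FF (nhds 0) := by
  have h1 : Filter.Tendsto (fun ε => 1 / LL ε) FF (nhds 0) := by
    simp only [one_div]
    exact tendsto_inv_atTop_zero.comp LL_tendsto
  have h2 := (Real.continuous_sqrt.comp Real.continuous_sqrt).tendsto 0
  simp only [Function.comp_apply, Real.sqrt_zero] at h2
  exact h2.comp h1

lemma rr_facts (ε : ℝ) (h : 1 ≤ LL ε) : 0 < rr ε ∧ rr ε ^ 4 = 1 / LL ε ∧ 1 / LL ε ≤ rr ε := by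
  have h0 : 0 < 1 / LL ε := by positivity
  have h1 : 1 / LL ε ≤ 1 := by rw [div_le_one (by linarith)]; exact h
  have hpos : 0 < rr ε := Real.sqrt_pos.mpr (Real.sqrt_pos.mpr h0)
  have h4 : rr ε ^ 4 = 1 / LL ε := by
    have e : rr ε ^ 4 = (rr ε ^ 2) ^ 2 := by ring
    rw [e]
    unfold rr
    rw [Real.sq_sqrt (Real.sqrt_nonneg _), Real.sq_sqrt h0.le]
  have hle : rr ε ≤ 1 := by
    unfold rr
    rw [Real.sqrt_le_iff]
    refine ⟨zero_le_one, ?_⟩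
    rw [one_pow, Real.sqrt_le_iff]
    refine ⟨zero_le_one, ?_⟩
    rw [one_pow]
    exact h1
  refine ⟨hpos, h4, ?_⟩
  rw [← h4]
  calc rr ε ^ 4 ≤ rr ε ^ 1 := pow_le_pow_of_le_one hpos.le hle (by norm_num)
    _ = rr ε := pow_one _

lemma eps_div_rr : Filter.Tendsto (fun ε => ε / rr ε) FF (nhds 0) := by
  have h1 : Filter.Tendsto (fun ε : ℝ => |Real.log ε * ε|) FF (nhds 0) := by
    have h := tendsto_log_mul_rpow_nhdsGT_zero (r := 1) one_pos
    simp only [Real.rpow_one] at h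
    have := (h.mono_left FF_le).abs
    simpa using this
  refine squeeze_zero' ?_ ?_ h1
  · filter_upwards [FF_mem] with ε hε
    exact div_nonneg hε.1.le (Real.sqrt_nonneg _)
  · filter_upwards [FF_mem, LL_tendsto.eventually_ge_atTop 1] with ε hε hL
    obtain ⟨a, b, c⟩ := rr_facts ε hL
    rw [abs_mul, abs_of_pos hε.1, div_le_iff₀ a]
    change ε ≤ LL ε * ε * rr ε
    rw [div_le_iff₀ (by linarith)] at c
    nlinarith [hε.1]

section final
variable {N : ℕ} (d : Fin N → ℤ) (x : Fin N → Plane)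

abbrev KK (d : Fin N → ℤ) : Type := (h : Fin N) × Fin (d h).natAbs

def sK (k : KK d) : ℤ := (d k.1).sign

noncomputable def y0 (ε : ℝ) (k : KK d) : ℝ := x k.1 0 + (k.2 : ℕ) * rr ε

noncomputable def cK (ε : ℝ) (k : KK d) : ℤ × ℤ := (⌊y0 d x ε k / ε⌋, ⌊x k.1 1 / ε⌋)

lemma sK_abs (hd : ∀ h, d h ≠ 0) (k : KK d) : |sK d k| = 1 := by
  unfold sK
  rw [Int.abs_sign_of_ne_zero (hd k.1)]

lemma card_KK : (Fintype.card (KK d) : ℝ) = ∑ h, |(d h : ℝ)| := by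
  rw [Fintype.card_sigma]
  push_cast
  refine Finset.sum_congr rfl fun h _ => ?_
  rw [Fintype.card_fin, Nat.cast_natAbs, Int.cast_abs]

lemma sum_KK (p : Plane) : (∑ h, if x h = p then (d h : ℝ) else 0) =
    ∑ k : KK d, if x k.1 = p then (sK d k : ℝ) else 0 := by
  rw [Fintype.sum_sigma]
  refine Finset.sum_congr rfl fun h _ => ?_
  simp only [sK]
  by_cases hp : x h = p
  · simp only [if_pos hp]
    rw [Finset.sum_const, Finset.card_univ, Fintype.card_fin, nsmul_eq_mul]
    have : ((d h).natAbs : ℤ) * (d h).sign = d h := by rw [mul_comm]; exact Int.sign_mul_natAbs _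
    have h2 := congrArg (fun z : ℤ => (z : ℝ)) this.symm
    simp only [Int.cast_mul, Int.cast_natCast] at h2
    exact h2
  · simp only [if_neg hp, Finset.sum_const_zero]

lemma floor_close (ε : ℝ) (hε : 0 < ε) (t : ℝ) :
    ε * ⌊t / ε⌋ ≤ t ∧ t ≤ ε * ⌊t / ε⌋ + ε := by
  have h1 := Int.floor_le (t / ε)
  have h2 := (Int.lt_floor_add_one (t / ε)).le
  rw [le_div_iff₀ hε] at h1
  rw [div_le_iff₀ hε] at h2
  constructor <;> linarith

lemma center_close (ε : ℝ) (hε : 0 < ε) (k : KK d) :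
    dist (center ε (cK d x ε k)) (x k.1) ≤ ε + (k.2 : ℕ) * rr ε := by
  refine (plane_dist_le _ _).trans ?_
  have h1 := floor_close ε hε (y0 d x ε k)
  have h2 := floor_close ε hε (x k.1 1)
  have hr : 0 ≤ ((k.2 : ℕ) : ℝ) * rr ε := mul_nonneg (by positivity) (Real.sqrt_nonneg _)
  have e0 : center ε (cK d x ε k) 0 = ε * ((⌊y0 d x ε k / ε⌋ : ℝ) + 1 / 2) := rfl
  have e1 : center ε (cK d x ε k) 1 = ε * ((⌊x k.1 1 / ε⌋ : ℝ) + 1 / 2) := rfl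
  rw [e0, e1]
  have a0 : |ε * ((⌊y0 d x ε k / ε⌋ : ℝ) + 1 / 2) - x k.1 0| ≤ ε / 2 + (k.2 : ℕ) * rr ε := by
    unfold y0 at *
    rw [abs_le]; constructor <;> linarith
  have a1 : |ε * ((⌊x k.1 1 / ε⌋ : ℝ) + 1 / 2) - x k.1 1| ≤ ε / 2 := by
    rw [abs_le]; constructor <;> linarith
  linarith

lemma center_tendsto (k : KK d) :
    Filter.Tendsto (fun ε => dist (center ε (cK d x ε k)) (x k.1)) FF (nhds 0) := by
  have h : Filter.Tendsto (fun ε => ε + ((k.2 : ℕ) : ℝ) * rr ε) FF (nhds 0) := by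
    have := FF_id.add (rr_tendsto.const_mul ((k.2 : ℕ) : ℝ))
    simpa using this
  refine squeeze_zero' (Filter.Eventually.of_forall fun _ => dist_nonneg) ?_ h
  filter_upwards [FF_mem] with ε hε
  exact center_close d x ε hε.1 k

lemma sep_ev (hxinj : Function.Injective x) (k l : KK d) (hkl : k ≠ l) :
    ∀ᶠ ε in FF, rr ε / (2 * ε) ≤ |((cK d x ε k).1 : ℝ) - (cK d x ε l).1| +
      |((cK d x ε k).2 : ℝ) - (cK d x ε l).2| := by
  have key : ∀ᶠ ε in FF, rr ε / 2 ≤ |y0 d x ε k - y0 d x ε l| + |x k.1 1 - x l.1 1| - 4 * ε := by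
    obtain ⟨h, j⟩ := k
    obtain ⟨h', j'⟩ := l
    by_cases hh : h = h'
    · subst hh
      have hj : (j : ℕ) ≠ (j' : ℕ) := by
        intro e; apply hkl; rw [Fin.ext e]
      have hj' : (1 : ℝ) ≤ |((j : ℕ) : ℝ) - ((j' : ℕ) : ℝ)| := by
        have : (1 : ℤ) ≤ |((j : ℕ) : ℤ) - ((j' : ℕ) : ℤ)| := by
          apply Int.one_le_abs; omega
        exact_mod_cast this
      filter_upwards [FF_mem, LL_tendsto.eventually_ge_atTop 1,
        eps_div_rr.eventually (gt_mem_nhds (by norm_num : (0 : ℝ) < 1 / 8))] with ε hε hL hsm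
      obtain ⟨a, b, c⟩ := rr_facts ε hL
      rw [div_lt_iff₀ a] at hsm
      have e : y0 d x ε ⟨h, j⟩ - y0 d x ε ⟨h, j'⟩ = (((j : ℕ) : ℝ) - ((j' : ℕ) : ℝ)) * rr ε := by
        unfold y0; simp only; ring
      rw [e, abs_mul, abs_of_pos a]
      have := abs_nonneg (x h 1 - x h 1)
      nlinarith
    · have hne : x h ≠ x h' := fun e => hh (hxinj e)
      have hσ : 0 < |x h 0 - x h' 0| + |x h 1 - x h' 1| :=
        lt_of_lt_of_le (dist_pos.mpr hne) (plane_dist_le _ _)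
      have ht : Filter.Tendsto (fun ε => |y0 d x ε ⟨h, j⟩ - y0 d x ε ⟨h', j'⟩| + |x h 1 - x h' 1|
          - 4 * ε - rr ε / 2) FF (nhds (|x h 0 - x h' 0| + |x h 1 - x h' 1|)) := by
        have t1 : ∀ k : KK d, Filter.Tendsto (fun ε => y0 d x ε k) FF (nhds (x k.1 0)) := by
          intro k
          have := (rr_tendsto.const_mul ((k.2 : ℕ) : ℝ)).const_add (x k.1 0)
          simpa [y0] using this
        have := ((((t1 ⟨h, j⟩).sub (t1 ⟨h', j'⟩)).abs.add_const (|x h 1 - x h' 1|)).sub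
          (FF_id.const_mul 4)).sub (rr_tendsto.div_const 2)
        simpa using this
      filter_upwards [ht.eventually (lt_mem_nhds hσ)] with ε h
      linarith
  filter_upwards [key, FF_mem] with ε h hε
  have h1 := floor_close ε hε.1 (y0 d x ε k)
  have h2 := floor_close ε hε.1 (x k.1 1)
  have h3 := floor_close ε hε.1 (y0 d x ε l)
  have h4 := floor_close ε hε.1 (x l.1 1)
  rw [div_le_iff₀ (by linarith)]
  unfold cK
  simp only
  set A := (⌊y0 d x ε k / ε⌋ : ℝ)
  set B := (⌊x k.1 1 / ε⌋ : ℝ)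
  set C := (⌊y0 d x ε l / ε⌋ : ℝ)
  set E := (⌊x l.1 1 / ε⌋ : ℝ)
  have b1 : |y0 d x ε k - y0 d x ε l| ≤ ε * |A - C| + ε := by
    have e : ε * |A - C| = |ε * A - ε * C| := by
      rw [← mul_sub, abs_mul, abs_of_pos hε.1]
    rw [e]
    have := le_abs_self (ε * A - ε * C)
    have := neg_abs_le (ε * A - ε * C)
    rw [abs_le]; constructor <;> linarith
  have b2 : |x k.1 1 - x l.1 1| ≤ ε * |B - E| + ε := by
    have e : ε * |B - E| = |ε * B - ε * E| := by
      rw [← mul_sub, abs_mul, abs_of_pos hε.1]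
    rw [e]
    have := le_abs_self (ε * B - ε * E)
    have := neg_abs_le (ε * B - ε * E)
    rw [abs_le]; constructor <;> linarith
  nlinarith [hε.1]

lemma good_ev (hxinj : Function.Injective x) :
    ∀ᶠ ε in FF, ∀ k l : KK d, k ≠ l → rr ε / (2 * ε) ≤ |((cK d x ε k).1 : ℝ) - (cK d x ε l).1| +
      |((cK d x ε k).2 : ℝ) - (cK d x ε l).2| := by
  rw [Filter.eventually_all]; intro k
  rw [Filter.eventually_all]; intro l
  rw [Filter.eventually_imp_distrib_left]
  exact sep_ev d x hxinj k l

lemma center_ev (Ω : Set Plane) (hΩo : IsOpen Ω) (hxΩ : ∀ h, x h ∈ Ω) :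
    ∀ᶠ ε in FF, ∀ k : KK d, center ε (cK d x ε k) ∈ Ω := by
  rw [Filter.eventually_all]; intro k
  have : Filter.Tendsto (fun ε => center ε (cK d x ε k)) FF (nhds (x k.1)) :=
    tendsto_iff_dist_tendsto_zero.mpr (center_tendsto d x k)
  exact this.eventually (hΩo.mem_nhds (hxΩ k.1))

end final

lemma final_bound (ε ρ L M R : ℝ) (n : ℕ) (hε : 0 < ε) (hε1 : ε < 1) (hL : 1 ≤ L) (hLe : L = |Real.log ε|)
    (hρ : 0 < ρ) (hρ4 : ρ ^ 4 = 1 / L) (hM : 0 ≤ M) (hR : 1 ≤ R) (hn : (n : ℝ) ≤ R / ε + 1) :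
    1 / L * ((1 + M * ρ) * (M * (Real.pi * Real.log ((2 * n + 1 : ℕ) : ℝ) + 100))
       + (2 * n + 1) ^ 2 * (M ^ 2 * ((8 / (ρ / (2 * ε))) ^ 2 / ρ))) ≤
    (1 + M * ρ) * (M * (Real.pi + (Real.pi * Real.log (2 * R + 3) + 100) * ρ ^ 4)) +
      256 * (2 * R + 3) ^ 2 * M ^ 2 * ρ := by
  have hpi := Real.pi_pos
  have h1 : (2 * n + 1 : ℝ) ≤ (2 * R + 3) / ε := by
    rw [le_div_iff₀ hε]
    have h2 : (n : ℝ) * ε ≤ R + ε := by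
      have := mul_le_mul_of_nonneg_right hn hε.le
      rwa [add_mul, div_mul_cancel₀ _ hε.ne', one_mul] at this
    nlinarith
  have h2 : Real.log ((2 * n + 1 : ℕ) : ℝ) ≤ Real.log (2 * R + 3) + L := by
    push_cast
    refine (Real.log_le_log (by positivity) h1).trans (le_of_eq ?_)
    rw [Real.log_div (by linarith) hε.ne', hLe, abs_of_neg (Real.log_neg hε hε1)]
    ring
  have h3 : (2 * n + 1 : ℝ) ^ 2 ≤ ((2 * R + 3) / ε) ^ 2 := by gcongr
  have hL4 : L = 1 / ρ ^ 4 := by rw [hρ4]; simp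
  calc _ ≤ 1 / L * ((1 + M * ρ) * (M * (Real.pi * (Real.log (2 * R + 3) + L) + 100))
       + ((2 * R + 3) / ε) ^ 2 * (M ^ 2 * ((8 / (ρ / (2 * ε))) ^ 2 / ρ))) := by gcongr
    _ = _ := by
      rw [hL4]
      field_simp
      ring

/-- Upper bound, zero order: for every `μ = Σ_{h<N} d_h δ_{x_h} ∈ X(Ω)` there is
a family `(u_ε)` of displacements whose restricted vorticity measures converge flat to `μ` as
`ε → 0` in `(0,1)`, with `limsup_{ε→0} (1/|log ε|)·F_ε^{edge}(u_ε,Ω) ≤ π|μ|(Ω)`. -/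
theorem stmt15 (Ω : Set Plane) (hΩo : IsOpen Ω) (hΩb : Bornology.IsBounded Ω)
    (hΩl : HasLipschitzBoundary Ω)
    (N : ℕ) (d : Fin N → ℤ) (x : Fin N → Plane)
    (hd : ∀ h, d h ≠ 0) (hxinj : Function.Injective x) (hxΩ : ∀ h, x h ∈ Ω) :
    ∃ u : ℝ → ℤ × ℤ → ℝ,
      Filter.Tendsto
        (fun ε => flatNorm Ω (fun p =>
          vortMeas ε (u ε) Ω p - ∑ h, if x h = p then (d h : ℝ) else 0))
        (nhdsWithin 0 (Set.Ioo (0 : ℝ) 1)) (nhds 0) ∧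
      Filter.limsup (fun ε => ENNReal.ofReal (1 / |Real.log ε|) * Fedge ε (u ε) Ω)
          (nhdsWithin 0 (Set.Ioo (0 : ℝ) 1))
        ≤ ENNReal.ofReal (Real.pi * ∑ h, |(d h : ℝ)|) := by
  set K := KK d with hK
  set M : ℝ := (Fintype.card (KK d) : ℝ) with hM
  have hs := sK_abs d hd
  obtain ⟨R0, hR0⟩ := hΩb.exists_norm_le
  set R : ℝ := max R0 1 with hR
  have hRΩ : ∀ p ∈ Ω, ‖p‖ ≤ R := fun p hp => (hR0 p hp).trans (le_max_left _ _)
  have hR1 : 1 ≤ R := le_max_right _ _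
  have hgood := good_ev d x hxinj
  have hcen := center_ev d x Ω hΩo hxΩ
  have hsmall : ∀ᶠ ε in FF, M * (8 / (rr ε / (2 * ε))) < 1 / 4 := by
    have h1 : Filter.Tendsto (fun ε => M * (16 * (ε / rr ε))) FF (nhds 0) := by
      simpa using (eps_div_rr.const_mul 16).const_mul M
    filter_upwards [h1.eventually (gt_mem_nhds (by norm_num : (0 : ℝ) < 1 / 4))] with ε h
    refine lt_of_eq_of_lt ?_ h
    rw [div_div_eq_mul_div]
    ring
  refine ⟨fun ε => uu (sK d) (cK d x ε), ?_, ?_⟩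
  · change Filter.Tendsto _ FF _
    have hlim : Filter.Tendsto (fun ε => ∑ k : KK d, dist (center ε (cK d x ε k)) (x k.1)) FF
        (nhds 0) := by
      have := tendsto_finsetSum (Finset.univ : Finset (KK d)) (fun k _ => center_tendsto d x k)
      simpa using this
    have heq : ∀ᶠ ε in FF, (fun p => vortMeas ε (uu (sK d) (cK d x ε)) Ω p -
        ∑ h, if x h = p then (d h : ℝ) else 0) = fun p =>
        (∑ k : KK d, if center ε (cK d x ε k) = p then (sK d k : ℝ) else 0) -
        ∑ k : KK d, if x k.1 = p then (sK d k : ℝ) else 0 := by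
      filter_upwards [hgood, hcen, hsmall, FF_mem, LL_tendsto.eventually_ge_atTop 1]
        with ε h1 h2 h3 hε hL
      obtain ⟨a, b, c⟩ := rr_facts ε hL
      funext p
      rw [sum_KK, vortMeas_eq (sK d) (cK d x ε) _ _ ε Ω h2 p]
      exact mCirc_uu (sK d) hs (cK d x ε) (rr ε / (2 * ε))
        (div_pos a (by linarith [hε.1])) h1 h3
    refine squeeze_zero' ?_ ?_ hlim
    · filter_upwards [heq] with ε h
      rw [h]
      exact (flat_le (sK d) hs _ (fun k => x k.1) Ω).1
    · filter_upwards [heq] with ε h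
      rw [h]
      exact (flat_le (sK d) hs _ (fun k => x k.1) Ω).2
  · change Filter.limsup _ FF ≤ _
    set Q : ℝ → ℝ := fun ρ =>
      (1 + M * ρ) * (M * (Real.pi + (Real.pi * Real.log (2 * R + 3) + 100) * ρ ^ 4)) +
      256 * (2 * R + 3) ^ 2 * M ^ 2 * ρ with hQ
    have hQ0 : Q 0 = Real.pi * ∑ h, |(d h : ℝ)| := by
      rw [← card_KK, hQ]; simp only; ring
    have hQc : Filter.Tendsto (fun ε => ENNReal.ofReal (Q (rr ε))) FF
        (nhds (ENNReal.ofReal (Real.pi * ∑ h, |(d h : ℝ)|))) := by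
      rw [← hQ0]
      have hc : Continuous Q := by rw [hQ]; fun_prop
      exact ENNReal.tendsto_ofReal ((hc.tendsto 0).comp rr_tendsto)
    rw [← hQc.limsup_eq]
    refine Filter.limsup_le_limsup ?_
    filter_upwards [hgood, hcen, FF_mem, LL_tendsto.eventually_ge_atTop 1] with ε h1 h2 hε hL
    obtain ⟨a, b, c⟩ := rr_facts ε hL
    have hε0 := hε.1
    set n : ℕ := ⌈R / ε⌉₊ with hn
    have hn1 : R / ε ≤ n := Nat.le_ceil _
    have hn2 : (n : ℝ) ≤ R / ε + 1 := (Nat.ceil_lt_add_one (by positivity)).le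
    have hbox : ∀ i, ε • toPlane i ∈ Ω → i ∈ box n := by
      intro i hi
      have hcoord : ∀ z : ℤ, |ε * (z : ℝ)| ≤ R → |z| ≤ n := by
        intro z hz
        rw [abs_mul, abs_of_pos hε0, mul_comm, ← le_div_iff₀ hε0] at hz
        have := hz.trans hn1
        exact_mod_cast this
      rw [mem_box]
      exact ⟨hcoord _ ((plane_abs_le (ε • toPlane i) 0).trans (hRΩ _ hi)),
        hcoord _ ((plane_abs_le (ε • toPlane i) 1).trans (hRΩ _ hi))⟩
    have hcb : ∀ k, cK d x ε k ∈ box (n + 1) := by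
      intro k
      have hcoord : ∀ z : ℤ, |ε * ((z : ℝ) + 1 / 2)| ≤ R → |z| ≤ (n + 1 : ℕ) := by
        intro z hz
        rw [abs_mul, abs_of_pos hε0, mul_comm, ← le_div_iff₀ hε0] at hz
        have := abs_le.mp (hz.trans hn1)
        have : |(z : ℝ)| ≤ (n : ℝ) + 1 := by
          rw [abs_le]; constructor <;> linarith
        exact_mod_cast this
      rw [mem_box]
      exact ⟨hcoord _ ((plane_abs_le (center ε (cK d x ε k)) 0).trans (hRΩ _ (h2 k))),
        hcoord _ ((plane_abs_le (center ε (cK d x ε k)) 1).trans (hRΩ _ (h2 k)))⟩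
    have hE := energy_le (sK d) hs (cK d x ε) (rr ε / (2 * ε)) (div_pos a (by linarith)) h1
      (rr ε) a ε Ω n hbox hcb
    refine (mul_le_mul_right hE _).trans ?_
    rw [← ENNReal.ofReal_mul (by positivity)]
    apply ENNReal.ofReal_le_ofReal
    exact final_bound ε (rr ε) (LL ε) M R n hε0 hε.2 hL rfl a b (by positivity) hR1 hn2
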